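/- Assume K satisfies (K1) and f is continuous on [0,∞). Let u be a solution of the radial equation on [0,ρ), ρ>0, with u(0)=α>0 and u'(0)=0. Then lim_{r→0⁺} |u'(r)|^{p-1} / K(r)^{1/p'} = 0. -/

import Mathlib

open Set Filter Topology MeasureTheory
open scoped ENNReal NNReal

noncomputable section

/-- `φ_p(s) = |s|^{p-2} s` (with the convention `φ_p(0)=0`). -/
def phiP (p s : ℝ) : ℝ := |s| ^ (p - 2) * s

/-- `K` is strictly positive and `C¹` on `(0,∞)` and satisfies condition (K1):
the map `r ↦ p + r·K'(r)/K(r)` is strictly positive and decreasing on `(0,∞)`. -/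
def CondK1 (p : ℝ) (K : ℝ → ℝ) : Prop :=
  (∀ r : ℝ, 0 < r → 0 < K r) ∧ ContDiffOn ℝ 1 K (Ioi 0) ∧
  (∀ r : ℝ, 0 < r → 0 < p + r * deriv K r / K r) ∧
  AntitoneOn (fun r => p + r * deriv K r / K r) (Ioi 0)

/-- (f1): `f(0)=0`, `f>0` above `u₀`, `f≤0` and not identically `0` on `(0,u₀)`. -/
def CondF1 (f : ℝ → ℝ) (u₀ : ℝ) : Prop :=
  f 0 = 0 ∧ (∀ v : ℝ, u₀ < v → 0 < f v) ∧ (∀ v ∈ Ioo 0 u₀, f v ≤ 0) ∧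
  ∃ v ∈ Ioo 0 u₀, f v ≠ 0

/-- (f2): `f` is continuous on `[0,∞)` and locally Lipschitz on `[u₀,∞)`. -/
def CondF2 (f : ℝ → ℝ) (u₀ : ℝ) : Prop :=
  ContinuousOn f (Ici 0) ∧ LocallyLipschitzOn (Ici u₀) f

/-- `D`: the set of differentiability points of `f` within `[u₀,∞)`. -/
def Dset (f : ℝ → ℝ) (u₀ : ℝ) : Set ℝ :=
  {v | v ∈ Ici u₀ ∧ DifferentiableWithinAt ℝ f (Ici u₀) v}

/-- the (one-sided) derivative `f'` of `f` on `[u₀,∞)`. -/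
def fder (f : ℝ → ℝ) (u₀ : ℝ) (v : ℝ) : ℝ := derivWithin f (Ici u₀) v

/-- (f3): `(p-1)f(u) ≤ f'(u)(u-u₀)` on `D`. -/
def CondF3 (p : ℝ) (f : ℝ → ℝ) (u₀ : ℝ) : Prop :=
  ∀ v ∈ Dset f u₀, (p - 1) * f v ≤ fder f u₀ v * (v - u₀)

/-- (f4): `u ↦ u·f'(u)/f(u)` is decreasing on `D`. -/
def CondF4 (f : ℝ → ℝ) (u₀ : ℝ) : Prop :=
  AntitoneOn (fun v => v * fder f u₀ v / f v) (Dset f u₀)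

/-- `u` is a solution of the radial equation
`(r^{n-1} φ_p(u'))' = -r^{n-1} K(r) f(u)` on the interval `I ⊆ [0,∞)`, `0 ∈ I`:
`u ∈ C¹(I)`, `r ↦ r^{n-1} φ_p(u'(r))` is `C¹` on `I` and the equation holds for `r ∈ I`, `r>0`. -/
def IsRadialSolution (p : ℝ) (n : ℕ) (K f : ℝ → ℝ) (I : Set ℝ) (u : ℝ → ℝ) : Prop :=
  (0:ℝ) ∈ I ∧ I ⊆ Ici 0 ∧
  ContDiffOn ℝ 1 u I ∧
  ContDiffOn ℝ 1 (fun r => r ^ (n - 1) * phiP p (derivWithin u I r)) I ∧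
  ∀ r ∈ I, 0 < r →
    HasDerivWithinAt (fun r => r ^ (n - 1) * phiP p (derivWithin u I r))
      (-(r ^ (n - 1) * K r * f (u r))) I r

/-- `F(s) = ∫₀^s f(t) dt`. -/
def Fint (f : ℝ → ℝ) (s : ℝ) : ℝ := ∫ t in (0:ℝ)..s, f t

theorem abs_phiP {p : ℝ} (hp : 1 < p) (s : ℝ) : |phiP p s| = |s| ^ (p - 1) := by
  rcases eq_or_ne s 0 with rfl | hs
  · simp [phiP, Real.zero_rpow (by linarith : p - 1 ≠ 0)]
  · have h : p - 1 = (p - 2) + 1 := by ring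
    rw [phiP, abs_mul, abs_of_nonneg (Real.rpow_nonneg (abs_nonneg s) _), h,
      Real.rpow_add_one (abs_ne_zero.mpr hs)]

namespace CondK1

variable {p : ℝ} {K : ℝ → ℝ}

theorem hasDerivAt (hK : CondK1 p K) {r : ℝ} (hr : 0 < r) : HasDerivAt K (deriv K r) r :=
  ((hK.2.1.differentiableOn one_ne_zero).differentiableAt (Ioi_mem_nhds hr)).hasDerivAt

/-- If `c` bounds `p + r K'(r) / K(r)` from below on `(0, R)`, then `r ^ (p - c) * K r` is
increasing on `(0, R)`. -/
theorem monotoneOn_rpow_mul (hK : CondK1 p K) {c R : ℝ}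
    (hc : ∀ r ∈ Ioo 0 R, c ≤ p + r * deriv K r / K r) :
    MonotoneOn (fun r => r ^ (p - c) * K r) (Ioo 0 R) := by
  have hd : ∀ r ∈ Ioo 0 R, HasDerivAt (fun r => r ^ (p - c) * K r)
      ((p - c) * r ^ (p - c - 1) * K r + r ^ (p - c) * deriv K r) r := fun r hr =>
    (Real.hasDerivAt_rpow_const (Or.inl hr.1.ne')).mul (hK.hasDerivAt hr.1)
  refine monotoneOn_of_deriv_nonneg (convex_Ioo 0 R)
    (fun r hr => (hd r hr).continuousAt.continuousWithinAt)
    (fun r hr => (hd r (interior_subset hr)).differentiableAt.differentiableWithinAt)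
    fun r hr => ?_
  replace hr := interior_subset hr
  have hKr := hK.1 r hr.1
  rw [(hd r hr).deriv]
  have hpow : r ^ (p - c) = r ^ (p - c - 1) * r := by
    rw [← Real.rpow_add_one hr.1.ne']; ring_nf
  have heq : (p - c) * r ^ (p - c - 1) * K r + r ^ (p - c) * deriv K r
      = r ^ (p - c - 1) * K r * (p + r * deriv K r / K r - c) := by
    rw [hpow]; field_simp; ring
  rw [heq]
  exact mul_nonneg (mul_nonneg (Real.rpow_nonneg hr.1.le _) hKr.le)
    (sub_nonneg.mpr (hc r hr))

theorem rpow_mul_le (hK : CondK1 p K) {s r : ℝ} (hs : 0 < s) (hsr : s ≤ r) :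
    s ^ p * K s ≤ r ^ p * K r := by
  have h := hK.monotoneOn_rpow_mul (c := 0) (R := r + 1) (fun x hx => (hK.2.2.1 x hx.1).le)
    (a := s) ⟨hs, by linarith⟩ (b := r) ⟨by linarith, by linarith⟩ hsr
  simpa using h

theorem tendsto_rpow_mul (hK : CondK1 p K) :
    Tendsto (fun r => r ^ p * K r) (𝓝[>] 0) (𝓝 0) := by
  set c := p + 2 * deriv K 2 / K 2
  have hc0 : 0 < c := hK.2.2.1 2 two_pos
  have hmono := hK.monotoneOn_rpow_mul (c := c) (R := 2) fun r hr =>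
    hK.2.2.2 (mem_Ioi.mpr hr.1) (mem_Ioi.mpr two_pos) hr.2.le
  have hlim : Tendsto (fun r : ℝ => r ^ c * K 1) (𝓝[>] 0) (𝓝 0) := by
    have h := ((Real.continuousAt_rpow_const 0 c (Or.inr hc0.le)).tendsto.mono_left
      (nhdsWithin_le_nhds (s := Ioi 0))).mul_const (K 1)
    simpa [Real.zero_rpow hc0.ne'] using h
  refine tendsto_of_tendsto_of_tendsto_of_le_of_le' tendsto_const_nhds hlim ?_ ?_
  · filter_upwards [self_mem_nhdsWithin] with r hr
    exact mul_nonneg (Real.rpow_nonneg (le_of_lt hr) _) (hK.1 r hr).le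
  · filter_upwards [Ioo_mem_nhdsGT (zero_lt_one' ℝ)] with r hr
    have h : r ^ (p - c) * K r ≤ 1 ^ (p - c) * K 1 :=
      hmono ⟨hr.1, by linarith [hr.2]⟩ ⟨one_pos, one_lt_two⟩ hr.2.le
    rw [Real.one_rpow, one_mul] at h
    calc r ^ p * K r = r ^ c * (r ^ (p - c) * K r) := by
          rw [← mul_assoc, ← Real.rpow_add hr.1]; ring_nf
      _ ≤ r ^ c * K 1 := mul_le_mul_of_nonneg_left h (Real.rpow_nonneg hr.1.le _)

end CondK1

/-- A function vanishing at `0` whose derivative on `(0, r)` is at most `A * s ^ (a - 1)` in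
absolute value is bounded by `A / a * r ^ a` at `r`. -/
theorem abs_le_of_abs_deriv_le_rpow {g g' : ℝ → ℝ} {A a r : ℝ} (ha : 0 < a) (hr : 0 < r)
    (hg0 : g 0 = 0) (hgc : ContinuousOn g (Icc 0 r))
    (hg : ∀ s ∈ Ioo 0 r, HasDerivAt g (g' s) s)
    (hbound : ∀ s ∈ Ioo 0 r, |g' s| ≤ A * s ^ (a - 1)) :
    |g r| ≤ A / a * r ^ a := by
  have hBc : ContinuousOn (fun s : ℝ => A / a * s ^ a) (Icc 0 r) :=
    ((Real.continuous_rpow_const ha.le).const_mul _).continuousOn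
  have hB : ∀ s ∈ Ioo 0 r, HasDerivAt (fun s : ℝ => A / a * s ^ a) (A * s ^ (a - 1)) s := by
    intro s hs
    have h := (Real.hasDerivAt_rpow_const (p := a) (Or.inl hs.1.ne')).const_mul (A / a)
    exact h.congr_deriv (by rw [← mul_assoc, div_mul_cancel₀ _ ha.ne'])
  have key : ∀ v v' : ℝ → ℝ, ContinuousOn v (Icc 0 r) → (∀ s ∈ Ioo 0 r, HasDerivAt v (v' s) s) →
      (∀ s ∈ Ioo 0 r, 0 ≤ v' s) → v 0 ≤ v r := by
    intro v v' hc hd hn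
    rw [← interior_Icc] at hd hn
    exact monotoneOn_of_deriv_nonneg (convex_Icc 0 r) hc
      (fun s hs => (hd s hs).differentiableAt.differentiableWithinAt)
      (fun s hs => (hd s hs).deriv.symm ▸ hn s hs)
      (left_mem_Icc.mpr hr.le) (right_mem_Icc.mpr hr.le) hr.le
  have h1 := key _ _ (hBc.sub hgc) (fun s hs => (hB s hs).sub (hg s hs))
    fun s hs => sub_nonneg.mpr ((le_abs_self _).trans (hbound s hs))
  have h2 := key _ _ (hBc.add hgc) (fun s hs => (hB s hs).add (hg s hs))
    fun s hs => by linarith [neg_abs_le (g' s), hbound s hs]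
  simp only [Pi.sub_apply, Pi.add_apply, hg0, Real.zero_rpow ha.ne', mul_zero] at h1 h2
  exact abs_le.mpr ⟨by linarith, by linarith⟩

/-- `lim_{r→0⁺} |u'(r)|^{p-1}/K(r)^{1/p'} = 0` (note `1/p' = (p-1)/p`). -/
theorem deriv_over_K_tendsto_zero_at_origin
    (p : ℝ) (n : ℕ) (hp : 1 < p) (hn : p < n)
    (K f : ℝ → ℝ) (hK : CondK1 p K) (hf : ContinuousOn f (Ici 0))
    (I : Set ℝ) (hI : I = Ici 0 ∨ ∃ ρ : ℝ, 0 < ρ ∧ I = Ico 0 ρ)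
    (u : ℝ → ℝ) (hu : IsRadialSolution p n K f I u)
    (α : ℝ) (hα : 0 < α) (hu0 : u 0 = α) (hu'0 : derivWithin u I 0 = 0) :
    Tendsto (fun r => |derivWithin u I r| ^ (p - 1) / K r ^ ((p - 1) / p))
      (𝓝[>] 0) (𝓝 0) := by
  obtain ⟨-, -, hu1, hg1, hode⟩ := hu
  have hn1 : 1 < n := by exact_mod_cast hp.trans hn
  have ha : (0:ℝ) < n - p := by linarith
  obtain ⟨R, hR, hRI⟩ : ∃ R : ℝ, 0 < R ∧ Ico 0 R ⊆ I := by
    rcases hI with rfl | ⟨ρ, hρ, rfl⟩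
    · exact ⟨1, one_pos, Ico_subset_Ici_self⟩
    · exact ⟨ρ, hρ, Subset.rfl⟩
  set M := |f α| + 1
  have hfu : Tendsto (fun s => |f (u s)|) (𝓝[I] 0) (𝓝 |f α|) := by
    have h1 : Tendsto u (𝓝[I] 0) (𝓝 α) :=
      hu0 ▸ hu1.continuousOn 0 (hRI ⟨le_rfl, hR⟩)
    exact ((hf.continuousAt (Ici_mem_nhds hα)).tendsto.comp h1).abs
  have hev : ∀ᶠ s in 𝓝[>] (0:ℝ), |f (u s)| < M := by
    have hle : 𝓝[>] (0:ℝ) ≤ 𝓝[I] 0 := by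
      rw [← nhdsWithin_Ioo_eq_nhdsGT hR]
      exact nhdsWithin_mono 0 (Ioo_subset_Ico_self.trans hRI)
    exact hle (hfu.eventually_lt_const (lt_add_one _))
  obtain ⟨δ, hδ, hδM⟩ := mem_nhdsGT_iff_exists_Ioo_subset.mp hev
  have hδ0 : 0 < δ := hδ
  have hlim : Tendsto (fun r => M / (n - p) * (r ^ p * K r) ^ (1 / p)) (𝓝[>] 0) (𝓝 0) := by
    have hp' : 0 < 1 / p := by positivity
    have h := ((Real.continuousAt_rpow_const 0 (1 / p) (Or.inr hp'.le)).tendsto.comp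
      hK.tendsto_rpow_mul).const_mul (M / (n - p))
    rwa [Real.zero_rpow hp'.ne', mul_zero] at h
  refine tendsto_of_tendsto_of_tendsto_of_le_of_le' tendsto_const_nhds hlim ?_ ?_
  · filter_upwards [self_mem_nhdsWithin] with r hr
    exact div_nonneg (Real.rpow_nonneg (abs_nonneg _) _) (Real.rpow_nonneg (hK.1 r hr).le _)
  filter_upwards [Ioo_mem_nhdsGT (lt_min hR hδ0)] with r hr
  have hr0 := hr.1
  have hrR : r < R := hr.2.trans_le (min_le_left _ _)
  have hrδ : r < δ := hr.2.trans_le (min_le_right _ _)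
  have hKr := hK.1 r hr0
  have hbound := abs_le_of_abs_deriv_le_rpow (A := M * (r ^ p * K r)) ha hr0
    (g := fun r => r ^ (n - 1) * phiP p (derivWithin u I r))
    (g' := fun s => -(s ^ (n - 1) * K s * f (u s)))
    (by simp [zero_pow (by omega : n - 1 ≠ 0)])
    (hg1.continuousOn.mono fun s hs => hRI ⟨hs.1, hs.2.trans_lt hrR⟩)
    (fun s hs => (hode s (hRI ⟨hs.1.le, hs.2.trans hrR⟩) hs.1).hasDerivAt
      (mem_of_superset (Ioo_mem_nhds hs.1 (hs.2.trans hrR)) (Ioo_subset_Ico_self.trans hRI)))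
    (fun s hs => by
      have hs0 := hs.1
      have hKs := hK.1 s hs0
      have hfs : |f (u s)| ≤ M := le_of_lt (hδM ⟨hs0, hs.2.trans hrδ⟩)
      have hpow : (s ^ (n - 1) : ℝ) = s ^ ((n:ℝ) - p - 1) * s ^ p := by
        rw [← Real.rpow_add hs0, ← Real.rpow_natCast, Nat.cast_sub hn1.le]
        congr 1; push_cast; ring
      rw [abs_neg, abs_mul, abs_of_pos (by positivity), hpow]
      calc s ^ ((n:ℝ) - p - 1) * s ^ p * K s * |f (u s)|
          = s ^ ((n:ℝ) - p - 1) * (s ^ p * K s * |f (u s)|) := by ring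
        _ ≤ s ^ ((n:ℝ) - p - 1) * (r ^ p * K r * M) := by
            have hKsr := hK.rpow_mul_le hs0 hs.2.le
            gcongr
        _ = M * (r ^ p * K r) * s ^ ((n:ℝ) - p - 1) := by ring)
  rw [abs_mul, abs_phiP hp, abs_of_pos (pow_pos hr0 _)] at hbound
  have hpow : r ^ p * r ^ ((n:ℝ) - p) = r ^ (n - 1) * r := by
    rw [← Real.rpow_add hr0, ← pow_succ, Nat.sub_add_cancel hn1.le, ← Real.rpow_natCast]
    congr 1; ring
  have hW : |derivWithin u I r| ^ (p - 1) ≤ M / (n - p) * (r * K r) := by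
    refine le_of_mul_le_mul_left (hbound.trans_eq ?_) (pow_pos hr0 (n - 1))
    calc M * (r ^ p * K r) / (n - p) * r ^ ((n:ℝ) - p)
        = M / (n - p) * K r * (r ^ p * r ^ ((n:ℝ) - p)) := by ring
      _ = _ := by rw [hpow]; ring
  rw [div_le_iff₀ (Real.rpow_pos_of_pos hKr _)]
  refine hW.trans_eq ?_
  have hp0 : p ≠ 0 := by linarith
  rw [Real.mul_rpow (Real.rpow_nonneg hr0.le _) hKr.le, ← Real.rpow_mul hr0.le,
    mul_one_div_cancel hp0, Real.rpow_one, mul_assoc, mul_assoc, ← Real.rpow_add hKr]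
  have : 1 / p + (p - 1) / p = 1 := by field_simp; ring
  rw [this, Real.rpow_one]
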